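/- Let f : ℝ^d → ℝ be a proper, nonnegative C² function, and let α > 0, β > 0 and a ∈ ℝ be constants such that Δf − α|∇f|² + βf ≤ a and Δf ≤ a hold everywhere on ℝ^d. Set γ = β/α and, for t ≥ 1, let φ_t = a·log t + (α/t^γ)·f. Then for every r > 0 and every T ≥ 1, ∫_{D_r} e^{−φ_T} dx ≤ ∫_{D_r} e^{−αf} dx, where D_r = {x ∈ ℝ^d : 2√(f(x)) ≤ √(2β)·r}. In particular, taking T = r^{2/γ} for r ≥ 1 gives r^{−2αa/β} ∫_{D_r} e^{−(α/r²)f} dx ≤ ∫_{D_r} e^{−αf} dx. -/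

import Mathlib

open MeasureTheory Real Gradient

/-- The Laplacian of a function on Euclidean space, as the trace of the second derivative. -/
noncomputable def lap {d : ℕ} (f : EuclideanSpace ℝ (Fin d) → ℝ)
    (x : EuclideanSpace ℝ (Fin d)) : ℝ :=
  ∑ i : Fin d,
    iteratedFDeriv ℝ 2 f x ![EuclideanSpace.single i 1, EuclideanSpace.single i 1]

lemma aux_integrable {d : ℕ} (f : EuclideanSpace ℝ (Fin d) → ℝ)
    (hf : Continuous f) (hf0 : ∀ x, 0 ≤ f x)
    (hproper : ∀ K : Set ℝ, IsCompact K → IsCompact (f ⁻¹' K))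
    (h : ℝ → ℝ) (hh : Continuous h) (M : ℝ) (hM : ∀ y, M < y → h y = 0)
    (g : EuclideanSpace ℝ (Fin d) → ℝ) (hg : Continuous g) :
    Integrable (fun x => h (f x) * g x) := by
  apply Continuous.integrable_of_hasCompactSupport
  · fun_prop
  · refine HasCompactSupport.intro (hproper (Set.Icc 0 M) isCompact_Icc) ?_
    intro x hx
    have : M < f x := by
      by_contra hc
      exact hx ⟨hf0 x, not_lt.mp hc⟩
    simp [hM _ this]

lemma aux_grad {d : ℕ} (f : EuclideanSpace ℝ (Fin d) → ℝ) (x : EuclideanSpace ℝ (Fin d)) :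
    ‖∇ f x‖ ^ 2 = ∑ i, (fderiv ℝ f x (EuclideanSpace.single i 1)) ^ 2 := by
  rw [EuclideanSpace.real_norm_sq_eq]
  congr 1 with i
  rw [← toDual_gradient, InnerProductSpace.toDual_apply_apply, EuclideanSpace.inner_single_right]
  simp

lemma aux_lap {d : ℕ} (f : EuclideanSpace ℝ (Fin d) → ℝ) (hf : ContDiff ℝ 2 f)
    (x : EuclideanSpace ℝ (Fin d)) :
    lap f x = ∑ i, fderiv ℝ (fun y => fderiv ℝ f y (EuclideanSpace.single i 1)) x
      (EuclideanSpace.single i 1) := by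
  unfold lap
  congr 1 with i
  rw [iteratedFDeriv_two_apply]
  have hd : DifferentiableAt ℝ (fderiv ℝ f) x :=
    ((hf.fderiv_right (m := 1) (by norm_num)).differentiable (by norm_num)) x
  rw [fderiv_clm_apply hd (differentiableAt_const _)]
  simp

lemma aux_ibp {d : ℕ} (f : EuclideanSpace ℝ (Fin d) → ℝ)
    (hf : ContDiff ℝ 2 f) (hf0 : ∀ x, 0 ≤ f x)
    (hproper : ∀ K : Set ℝ, IsCompact K → IsCompact (f ⁻¹' K))
    (h : ℝ → ℝ) (hh : ContDiff ℝ 1 h) (M : ℝ) (hM : ∀ y, M < y → h y = 0) :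
    ∫ x, h (f x) * lap f x = - ∫ x, deriv h (f x) * ‖∇ f x‖ ^ 2 := by
  have hfc := hf.continuous
  have hf1 : ContDiff ℝ 1 (fderiv ℝ f) := hf.fderiv_right (by norm_num)
  have hdc : Continuous (deriv h) := hh.continuous_deriv (by norm_num)
  have hdM : ∀ y, M < y → deriv h y = 0 := by
    intro y hy
    have : h =ᶠ[nhds y] fun _ => 0 := by
      filter_upwards [lt_mem_nhds hy] with z hz using hM z hz
    rw [this.deriv_eq]; simp
  have hgi : ∀ i : Fin d, ContDiff ℝ 1 (fun y => fderiv ℝ f y (EuclideanSpace.single i 1)) :=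
    fun i => hf1.clm_apply contDiff_const
  have hchain : ∀ x v, fderiv ℝ (fun x => h (f x)) x v = deriv h (f x) * fderiv ℝ f x v := by
    intro x v
    have h1 : HasDerivAt h (deriv h (f x)) (f x) :=
      ((hh.differentiable (by norm_num)) (f x)).hasDerivAt
    have h2 := ((hf.differentiable (by norm_num)) x).hasFDerivAt
    have := (h1.comp_hasFDerivAt x h2).fderiv
    change fderiv ℝ (h ∘ f) x v = _
    rw [this]; simp
  simp_rw [aux_lap f hf, aux_grad, Finset.mul_sum]
  have I1 : ∀ i : Fin d, Integrable (fun x => h (f x) *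
      fderiv ℝ (fun y => fderiv ℝ f y (EuclideanSpace.single i 1)) x
      (EuclideanSpace.single i 1)) := fun i =>
    aux_integrable f hfc hf0 hproper h hh.continuous M hM _
      (((hgi i).continuous_fderiv (by norm_num)).clm_apply continuous_const)
  have I2 : ∀ i : Fin d, Integrable (fun x => deriv h (f x) *
      (fderiv ℝ f x (EuclideanSpace.single i 1)) ^ 2) := fun i =>
    aux_integrable f hfc hf0 hproper _ hdc M hdM _ ((hgi i).continuous.pow 2)
  rw [integral_finsetSum _ (fun i _ => I1 i), integral_finsetSum _ (fun i _ => I2 i),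
    ← Finset.sum_neg_distrib]
  congr 1 with i
  have e : ∀ x, fderiv ℝ (fun x => h (f x)) x (EuclideanSpace.single i 1) *
      fderiv ℝ f x (EuclideanSpace.single i 1) = deriv h (f x) *
      (fderiv ℝ f x (EuclideanSpace.single i 1)) ^ 2 := by
    intro x; rw [hchain]; ring
  rw [integral_mul_fderiv_eq_neg_fderiv_mul_of_integrable (f := fun x => h (f x))
    (g := fun y => fderiv ℝ f y (EuclideanSpace.single i 1))]
  · simp_rw [e]
  · simp_rw [e]; exact I2 i
  · exact I1 i
  · exact aux_integrable f hfc hf0 hproper h hh.continuous M hM _ (hgi i).continuous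
  · intro x _
    exact ((hh.comp (hf.of_le (by norm_num))).differentiable (by norm_num)) x
  · intro x _
    exact ((hgi i).differentiable (by norm_num)) x

lemma aux_key {d : ℕ} (f : EuclideanSpace ℝ (Fin d) → ℝ)
    (hf : ContDiff ℝ 2 f) (hf0 : ∀ x, 0 ≤ f x)
    (hproper : ∀ K : Set ℝ, IsCompact K → IsCompact (f ⁻¹' K))
    (α β a : ℝ) (h1 : ∀ x, lap f x - α * ‖∇ f x‖ ^ 2 + β * f x ≤ a)
    (h2 : ∀ x, lap f x ≤ a)
    (χ : ℝ → ℝ) (hχ : ContDiff ℝ 1 χ) (hχ0 : ∀ y, 0 ≤ χ y) (hχa : Antitone χ)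
    (M : ℝ) (hM : ∀ y, M < y → χ y = 0) (s : ℝ) (hs0 : 0 ≤ s) (hs1 : s ≤ 1) :
    ∫ x, χ (f x) * ((-a + β * s * f x) * rexp (-(α * s * f x))) ≤ 0 := by
  have hfc := hf.continuous
  set h : ℝ → ℝ := fun y => χ y * rexp (-(α * s * y)) with hh_def
  have hh : ContDiff ℝ 1 h := by
    apply hχ.mul; fun_prop
  have hhM : ∀ y, M < y → h y = 0 := fun y hy => by simp [h, hM y hy]
  have hh0 : ∀ y, 0 ≤ h y := fun y => mul_nonneg (hχ0 y) (exp_pos _).le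
  have hd : ∀ y, deriv h y = deriv χ y * rexp (-(α * s * y)) - α * s * h y := by
    intro y
    have A : HasDerivAt χ (deriv χ y) y := ((hχ.differentiable (by norm_num)) y).hasDerivAt
    have B : HasDerivAt (fun y => rexp (-(α * s * y))) (rexp (-(α * s * y)) * (-(α * s * 1))) y :=
      (((hasDerivAt_id y).const_mul (α * s)).neg).exp
    have AB : HasDerivAt h _ y := A.mul B
    rw [AB.deriv]; simp only [h]; ring
  have hd' : ∀ y, deriv h y ≤ - (α * s * h y) := by
    intro y
    rw [hd]
    have : deriv χ y ≤ 0 := hχa.deriv_nonpos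
    nlinarith [exp_pos (-(α * s * y))]
  have hdM : ∀ y, M < y → deriv h y = 0 := by
    intro y hy
    have : h =ᶠ[nhds y] fun _ => 0 := by
      filter_upwards [lt_mem_nhds hy] with z hz using hhM z hz
    rw [this.deriv_eq]; simp
  have hgc : Continuous (fun x => ‖∇ f x‖ ^ 2) := by
    have : Continuous (∇ f) := by
      unfold gradient
      exact (LinearIsometryEquiv.continuous _).comp (hf.continuous_fderiv (by norm_num))
    fun_prop
  have hlc : Continuous (lap f) := by
    have e : lap f = fun x => _ := funext (aux_lap f hf)
    rw [e]
    refine continuous_finsetSum _ fun i _ => ?_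
    have hf1 : ContDiff ℝ 1 (fderiv ℝ f) := hf.fderiv_right (by norm_num)
    have hgi : ContDiff ℝ 1 (fun y => fderiv ℝ f y (EuclideanSpace.single i 1)) :=
      hf1.clm_apply contDiff_const
    exact (hgi.continuous_fderiv (by norm_num)).clm_apply continuous_const
  have ibp := aux_ibp f hf hf0 hproper h hh M hhM
  have J1 := aux_integrable f hfc hf0 hproper h hh.continuous M hhM _ hlc
  have J2 := aux_integrable f hfc hf0 hproper _ (hh.continuous_deriv (by norm_num)) M hdM _ hgc
  have J3 := aux_integrable f hfc hf0 hproper h hh.continuous M hhM (fun x => -a + β * s * f x)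
    (by fun_prop)
  have : ∫ x, h (f x) * (-a + β * s * f x) ≤
      ∫ x, -(h (f x) * lap f x) + -(deriv h (f x) * ‖∇ f x‖ ^ 2) := by
    refine integral_mono J3 (J1.neg.add J2.neg) fun x => ?_
    have p1 := mul_le_mul_of_nonneg_left (h1 x) hs0
    have p2 := mul_le_mul_of_nonneg_left (h2 x) (sub_nonneg.mpr hs1)
    have p3 : -a + β * s * f x ≤ - lap f x + α * s * ‖∇ f x‖ ^ 2 := by nlinarith
    have p4 := mul_le_mul_of_nonneg_left p3 (hh0 (f x))
    have p5 := mul_le_mul_of_nonneg_right (hd' (f x)) (sq_nonneg ‖∇ f x‖)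
    show h (f x) * (-a + β * s * f x) ≤ -(h (f x) * lap f x) + -(deriv h (f x) * ‖∇ f x‖ ^ 2)
    nlinarith
  have J1n : Integrable (fun x => -(h (f x) * lap f x)) := J1.neg
  have J2n : Integrable (fun x => -(deriv h (f x) * ‖∇ f x‖ ^ 2)) := J2.neg
  rw [integral_add J1n J2n, integral_neg, integral_neg, ibp] at this
  calc _ = ∫ x, h (f x) * (-a + β * s * f x) := by
        congr 1 with x; simp only [h]; ring
    _ ≤ _ := this
    _ = 0 := by ring

lemma aux_mono {d : ℕ} (f : EuclideanSpace ℝ (Fin d) → ℝ)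
    (hf : ContDiff ℝ 2 f) (hf0 : ∀ x, 0 ≤ f x)
    (hproper : ∀ K : Set ℝ, IsCompact K → IsCompact (f ⁻¹' K))
    (α β a : ℝ) (hα : 0 < α) (hβ : 0 < β)
    (h1 : ∀ x, lap f x - α * ‖∇ f x‖ ^ 2 + β * f x ≤ a)
    (h2 : ∀ x, lap f x ≤ a)
    (χ : ℝ → ℝ) (hχ : ContDiff ℝ 1 χ) (hχ0 : ∀ y, 0 ≤ χ y) (hχa : Antitone χ)
    (M : ℝ) (hM : ∀ y, M < y → χ y = 0) (τ : ℝ) (hτ : 0 ≤ τ) :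
    ∫ x, χ (f x) * rexp (-(a * τ + α * rexp (-(β / α * τ)) * f x)) ≤
    ∫ x, χ (f x) * rexp (-(α * f x)) := by
  have hfc := hf.continuous
  have hχc := hχ.continuous
  set F : ℝ → EuclideanSpace ℝ (Fin d) → ℝ :=
    fun τ x => χ (f x) * rexp (-(a * τ + α * rexp (-(β / α * τ)) * f x)) with hF
  set F' : ℝ → EuclideanSpace ℝ (Fin d) → ℝ :=
    fun τ x => χ (f x) * ((-a + β * rexp (-(β / α * τ)) * f x) *
      rexp (-(a * τ + α * rexp (-(β / α * τ)) * f x))) with hF'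
  have hder : ∀ x τ, HasDerivAt (fun τ => F τ x) (F' τ x) τ := by
    intro x τ
    have A : HasDerivAt (fun τ => rexp (-(β / α * τ)))
        (rexp (-(β / α * τ)) * (-(β / α * 1))) τ :=
      (((hasDerivAt_id τ).const_mul (β / α)).neg).exp
    have B := (((((hasDerivAt_id τ).const_mul a).add
      ((A.const_mul α).mul_const (f x))).neg).exp).const_mul (χ (f x))
    refine B.congr_deriv ?_
    simp only [hF', id, Pi.add_apply, Pi.neg_apply]
    field_simp
    ring
  have hK : IsCompact (f ⁻¹' Set.Icc 0 M) := hproper _ isCompact_Icc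
  have hF'c : Continuous (fun p : ℝ × EuclideanSpace ℝ (Fin d) => F' p.1 p.2) := by
    simp only [hF']; fun_prop
  have hD : ∀ τ, HasDerivAt (fun τ => ∫ x, F τ x) (∫ x, F' τ x) τ := by
    intro τ
    obtain ⟨C, hC⟩ := ((isCompact_closedBall τ 1).prod hK).exists_bound_of_continuousOn
      hF'c.continuousOn
    refine (hasDerivAt_integral_of_dominated_loc_of_deriv_le (μ := volume)
      (F := F) (F' := F') (s := Metric.closedBall τ 1)
      (bound := (f ⁻¹' Set.Icc 0 M).indicator fun _ => C)
      (Metric.closedBall_mem_nhds τ one_pos) ?_ ?_ ?_ ?_ ?_ ?_).2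
    · refine Filter.Eventually.of_forall fun t => Continuous.aestronglyMeasurable ?_
      simp only [hF]; fun_prop
    · exact aux_integrable f hfc hf0 hproper χ hχc M hM _ (by fun_prop)
    · refine Continuous.aestronglyMeasurable ?_
      simp only [hF']; fun_prop
    · refine Filter.Eventually.of_forall fun x t ht => ?_
      by_cases hx : x ∈ f ⁻¹' Set.Icc 0 M
      · rw [Set.indicator_of_mem hx]
        exact hC (t, x) ⟨ht, hx⟩
      · rw [Set.indicator_of_notMem hx]
        have : M < f x := by
          by_contra hc
          exact hx ⟨hf0 x, not_lt.mp hc⟩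
        simp [hF', hM _ this]
    · rw [integrable_indicator_iff hK.measurableSet]
      exact integrableOn_const hK.measure_lt_top.ne (by simp)
    · exact Filter.Eventually.of_forall fun x t _ => hder x t
  have hanti : AntitoneOn (fun τ => ∫ x, F τ x) (Set.Ici 0) := by
    refine antitoneOn_of_deriv_nonpos (convex_Ici 0)
      (fun t _ => (hD t).continuousAt.continuousWithinAt)
      (fun t _ => (hD t).differentiableAt.differentiableWithinAt) fun t ht => ?_
    rw [(hD t).deriv]
    rw [interior_Ici] at ht
    have ht : 0 < t := ht
    have k := aux_key f hf hf0 hproper α β a h1 h2 χ hχ hχ0 hχa M hM (rexp (-(β / α * t)))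
      (exp_pos _).le (exp_le_one_iff.mpr (by have := div_pos hβ hα; nlinarith))
    have e : ∀ x, F' t x = rexp (-(a * t)) * (χ (f x) * ((-a + β * rexp (-(β / α * t)) * f x) *
        rexp (-(α * rexp (-(β / α * t)) * f x)))) := by
      intro x
      simp only [hF']
      rw [neg_add, Real.exp_add]; ring
    simp_rw [e]
    rw [integral_const_mul]
    exact mul_nonpos_of_nonneg_of_nonpos (exp_pos _).le k
  have := hanti (Set.mem_Ici.mpr le_rfl) (Set.mem_Ici.mpr hτ) hτ
  simpa [hF] using this

lemma aux_final {d : ℕ} (f : EuclideanSpace ℝ (Fin d) → ℝ)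
    (hf : ContDiff ℝ 2 f) (hf0 : ∀ x, 0 ≤ f x)
    (hproper : ∀ K : Set ℝ, IsCompact K → IsCompact (f ⁻¹' K))
    (α β a : ℝ) (hα : 0 < α) (hβ : 0 < β)
    (h1 : ∀ x, lap f x - α * ‖∇ f x‖ ^ 2 + β * f x ≤ a)
    (h2 : ∀ x, lap f x ≤ a) (c : ℝ) (τ : ℝ) (hτ : 0 ≤ τ) :
    (∫⁻ x in {x | f x ≤ c},
      ENNReal.ofReal (rexp (-(a * τ + α * rexp (-(β / α * τ)) * f x)))) ≤
    ∫⁻ x in {x | f x ≤ c}, ENNReal.ofReal (rexp (-(α * f x))) := by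
  have hfc := hf.continuous
  have hDm : MeasurableSet {x | f x ≤ c} := (isClosed_le hfc continuous_const).measurableSet
  set χ : ℕ → ℝ → ℝ := fun n y => Real.smoothTransition (1 - (n + 1) * (y - c)) with hχd
  have hχ : ∀ n, ContDiff ℝ 1 (χ n) := fun n =>
    (Real.smoothTransition.contDiff (n := 1)).comp (by fun_prop)
  have hχ0 : ∀ n y, 0 ≤ χ n y := fun n y => Real.smoothTransition.nonneg _
  have hχ1 : ∀ n y, χ n y ≤ 1 := fun n y => Real.smoothTransition.le_one _
  have hχa : ∀ n, Antitone (χ n) := by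
    intro n y z hyz
    apply Real.smoothTransition.monotone
    have : (0:ℝ) ≤ n := n.cast_nonneg
    nlinarith
  have hχM : ∀ n y, c + 1 < y → χ n y = 0 := by
    intro n y hy
    apply Real.smoothTransition.zero_of_nonpos
    have : (0:ℝ) ≤ n := n.cast_nonneg
    nlinarith
  have hχD : ∀ n y, y ≤ c → χ n y = 1 := by
    intro n y hy
    apply Real.smoothTransition.one_of_one_le
    have : (0:ℝ) ≤ n := n.cast_nonneg
    nlinarith
  have key : ∀ n, (∫⁻ x, ENNReal.ofReal (χ n (f x) *
        rexp (-(a * τ + α * rexp (-(β / α * τ)) * f x)))) ≤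
      ∫⁻ x, ENNReal.ofReal (χ n (f x) * rexp (-(α * f x))) := by
    intro n
    rw [← ofReal_integral_eq_lintegral_ofReal, ← ofReal_integral_eq_lintegral_ofReal]
    · exact ENNReal.ofReal_le_ofReal (aux_mono f hf hf0 hproper α β a hα hβ h1 h2 (χ n) (hχ n)
        (hχ0 n) (hχa n) (c + 1) (hχM n) τ hτ)
    · exact aux_integrable f hfc hf0 hproper _ (hχ n).continuous _ (hχM n) _ (by fun_prop)
    · exact Filter.Eventually.of_forall fun x => mul_nonneg (hχ0 n _) (exp_pos _).le
    · exact aux_integrable f hfc hf0 hproper _ (hχ n).continuous _ (hχM n) _ (by fun_prop)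
    · exact Filter.Eventually.of_forall fun x => mul_nonneg (hχ0 n _) (exp_pos _).le
  have lower : ∀ n, (∫⁻ x in {x | f x ≤ c},
      ENNReal.ofReal (rexp (-(a * τ + α * rexp (-(β / α * τ)) * f x)))) ≤
      ∫⁻ x, ENNReal.ofReal (χ n (f x) *
        rexp (-(a * τ + α * rexp (-(β / α * τ)) * f x))) := by
    intro n
    rw [← lintegral_indicator hDm]
    refine lintegral_mono fun x => ?_
    by_cases hx : f x ≤ c
    · rw [Set.indicator_of_mem (show x ∈ {x | f x ≤ c} from hx), hχD n _ hx, one_mul]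
    · rw [Set.indicator_of_notMem (show x ∉ {x | f x ≤ c} from hx)]; exact bot_le
  have hK : IsCompact (f ⁻¹' Set.Icc 0 (c + 1)) := hproper _ isCompact_Icc
  have lim : Filter.Tendsto (fun n => ∫⁻ x, ENNReal.ofReal (χ n (f x) * rexp (-(α * f x))))
      Filter.atTop (nhds (∫⁻ x in {x | f x ≤ c}, ENNReal.ofReal (rexp (-(α * f x))))) := by
    rw [← lintegral_indicator hDm]
    refine tendsto_lintegral_of_dominated_convergence
      ((f ⁻¹' Set.Icc 0 (c + 1)).indicator fun _ => 1) ?_ ?_ ?_ ?_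
    · intro n
      have := (hχ n).continuous
      exact (Continuous.measurable (by fun_prop)).ennreal_ofReal
    · intro n
      refine Filter.Eventually.of_forall fun x => ?_
      by_cases hx : x ∈ f ⁻¹' Set.Icc 0 (c + 1)
      · rw [Set.indicator_of_mem hx]
        rw [ENNReal.ofReal_le_one]
        exact mul_le_one₀ (hχ1 n _) (exp_pos _).le
          (exp_le_one_iff.mpr (by have := mul_nonneg hα.le (hf0 x); linarith))
      · have : c + 1 < f x := by
          by_contra hc
          exact hx ⟨hf0 x, not_lt.mp hc⟩
        simp [hχM n _ this]
    · rw [lintegral_indicator hK.measurableSet]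
      simpa using hK.measure_lt_top.ne
    · refine Filter.Eventually.of_forall fun x => ?_
      by_cases hx : f x ≤ c
      · rw [Set.indicator_of_mem (show x ∈ {x | f x ≤ c} from hx)]
        simp only [hχD _ _ hx, one_mul]
        exact tendsto_const_nhds
      · rw [Set.indicator_of_notMem (show x ∉ {x | f x ≤ c} from hx)]
        refine tendsto_const_nhds.congr' ?_
        push Not at hx
        obtain ⟨N, hN⟩ := exists_nat_gt (1 / (f x - c))
        filter_upwards [Filter.eventually_ge_atTop N] with n hn
        have hpos : 0 < f x - c := by linarith
        have : χ n (f x) = 0 := by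
          apply Real.smoothTransition.zero_of_nonpos
          have h3 : (N : ℝ) ≤ n := by exact_mod_cast hn
          rw [div_lt_iff₀ hpos] at hN
          nlinarith
        simp [this]
  exact ge_of_tendsto' lim fun n => (lower n).trans (key n)

theorem weighted_integral_monotonicity {d : ℕ} (f : EuclideanSpace ℝ (Fin d) → ℝ)
    (hf : ContDiff ℝ 2 f) (hf0 : ∀ x, 0 ≤ f x)
    (hproper : ∀ K : Set ℝ, IsCompact K → IsCompact (f ⁻¹' K))
    (α β a : ℝ) (hα : 0 < α) (hβ : 0 < β)
    (h1 : ∀ x, lap f x - α * ‖∇ f x‖ ^ 2 + β * f x ≤ a)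
    (h2 : ∀ x, lap f x ≤ a) :
    (∀ r : ℝ, 0 < r → ∀ T : ℝ, 1 ≤ T →
        (∫⁻ x in {x : EuclideanSpace ℝ (Fin d) | 2 * Real.sqrt (f x) ≤ Real.sqrt (2 * β) * r},
            ENNReal.ofReal (Real.exp (-(a * Real.log T + α / T ^ (β / α) * f x)))) ≤
          ∫⁻ x in {x : EuclideanSpace ℝ (Fin d) | 2 * Real.sqrt (f x) ≤ Real.sqrt (2 * β) * r},
            ENNReal.ofReal (Real.exp (-(α * f x)))) ∧
      ∀ r : ℝ, 1 ≤ r →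
        ENNReal.ofReal (r ^ (-(2 * α * a / β))) *
            ∫⁻ x in {x : EuclideanSpace ℝ (Fin d) | 2 * Real.sqrt (f x) ≤ Real.sqrt (2 * β) * r},
              ENNReal.ofReal (Real.exp (-(α / r ^ 2) * f x)) ≤
          ∫⁻ x in {x : EuclideanSpace ℝ (Fin d) | 2 * Real.sqrt (f x) ≤ Real.sqrt (2 * β) * r},
            ENNReal.ofReal (Real.exp (-(α * f x))) := by
  have hset : ∀ r : ℝ, 0 < r →
      {x : EuclideanSpace ℝ (Fin d) | 2 * Real.sqrt (f x) ≤ Real.sqrt (2 * β) * r} =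
      {x | f x ≤ β * r ^ 2 / 2} := by
    intro r hr
    ext x
    simp only [Set.mem_ofPred_eq]
    rw [← sq_le_sq₀ (by positivity) (by positivity), mul_pow, mul_pow, Real.sq_sqrt (hf0 x),
      Real.sq_sqrt (by positivity)]
    constructor <;> intro h <;> linarith
  have P1 : ∀ r : ℝ, 0 < r → ∀ T : ℝ, 1 ≤ T →
        (∫⁻ x in {x : EuclideanSpace ℝ (Fin d) | 2 * Real.sqrt (f x) ≤ Real.sqrt (2 * β) * r},
            ENNReal.ofReal (Real.exp (-(a * Real.log T + α / T ^ (β / α) * f x)))) ≤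
          ∫⁻ x in {x : EuclideanSpace ℝ (Fin d) | 2 * Real.sqrt (f x) ≤ Real.sqrt (2 * β) * r},
            ENNReal.ofReal (Real.exp (-(α * f x))) := by
    intro r hr T hT
    rw [hset r hr]
    have hT0 : 0 < T := by linarith
    have e : α / T ^ (β / α) = α * rexp (-(β / α * Real.log T)) := by
      rw [Real.rpow_def_of_pos hT0, Real.exp_neg, mul_comm (Real.log T), div_eq_mul_inv]
    rw [e]
    exact aux_final f hf hf0 hproper α β a hα hβ h1 h2 _ _ (Real.log_nonneg hT)
  refine ⟨P1, fun r hr => ?_⟩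
  have hr0 : 0 < r := by linarith
  have h := P1 r hr0 (r ^ (2 * α / β)) (Real.one_le_rpow hr (by positivity))
  refine le_of_eq_of_le ?_ h
  rw [← lintegral_const_mul' _ _ ENNReal.ofReal_ne_top]
  congr 1 with x
  rw [← ENNReal.ofReal_mul (by positivity), Real.log_rpow hr0, ← Real.rpow_mul hr0.le,
    Real.rpow_def_of_pos hr0, ← Real.exp_add]
  have e2 : 2 * α / β * (β / α) = ((2 : ℕ) : ℝ) := by field_simp; norm_num
  rw [e2, Real.rpow_natCast]
  congr 2
  ring
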